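/- Every integral partial polytopal complex (a finite disjoint union of relatively open lattice polytopes) of dimension at most d has an Ehrhart polynomial whose f*-vector with respect to d is a non-negative integer vector. In particular every lattice polytope has a non-negative integral f*-vector. -/

import Mathlib

open Polynomial Pointwise

/-- The polynomial `binomial (k-1) i` in the variable `k`. -/
noncomputable def binomDesc (i : ℕ) : Polynomial ℚ :=
  C ((i.factorial : ℚ)⁻¹) * ∏ j ∈ Finset.range i, (X - C ((j : ℚ) + 1))

/-- The relatively open lattice polytope with vertex set `V ⊆ ℤ^n`: the relative
interior of the convex hull of `V`. -/
noncomputable def openLatticePolytope (n : ℕ) (V : Finset (Fin n → ℤ)) :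
    Set (Fin n → ℝ) :=
  intrinsicInterior ℝ (convexHull ℝ ((fun z : Fin n → ℤ => fun j => ((z j : ℝ))) '' V))

lemma binomDesc_eval (i : ℕ) {k : ℕ} (hk : 1 ≤ k) :
    (binomDesc i).eval (k : ℚ) = ((k - 1).choose i : ℚ) := by
  have h : (descPochhammer ℚ i).eval (((k - 1 : ℕ) : ℚ)) =
      ∏ j ∈ Finset.range i, ((k : ℚ) - (j + 1)) := by
    rw [descPochhammer_eval_eq_prod_range]
    refine Finset.prod_congr rfl fun j _ => ?_
    rw [Nat.cast_sub hk]
    push_cast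
    ring
  rw [Nat.cast_choose_eq_descPochhammer_div, h]
  simp only [binomDesc, eval_mul, eval_C, eval_prod, eval_sub, eval_X]
  rw [div_eq_inv_mul]

/-- Lexicographic positivity: the first nonzero coordinate of `c` is positive. -/
def LexPos {m : ℕ} (c : Fin m → ℝ) : Prop :=
  ∃ i, (∀ j < i, c j = 0) ∧ 0 < c i

lemma LexPos.not_neg {m : ℕ} {c : Fin m → ℝ} (h : LexPos c) : ¬ LexPos (-c) := by
  rintro ⟨i', h0', h'⟩
  obtain ⟨i, h0, h⟩ := h
  rcases lt_trichotomy i i' with hlt | rfl | hlt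
  · have := h0' i hlt
    simp only [Pi.neg_apply, neg_eq_zero] at this
    linarith
  · simp only [Pi.neg_apply] at h'
    linarith
  · have := h0 i' hlt
    simp only [Pi.neg_apply] at h'
    linarith

lemma LexPos.of_smul {m : ℕ} {c : Fin m → ℝ} {ε : ℝ} (hε : 0 < ε) (h : LexPos (ε • c)) :
    LexPos c := by
  obtain ⟨i, h0, h⟩ := h
  refine ⟨i, fun j hj => ?_, ?_⟩
  · simpa [hε.ne'] using h0 j hj
  · simpa [hε] using h

/-- A nonempty compact set has a lexicographically least element. -/
lemma IsCompact.exists_lexMin {m : ℕ} {K : Set (Fin m → ℝ)} (hK : IsCompact K)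
    (hne : K.Nonempty) : ∃ a ∈ K, ∀ b ∈ K, b ≠ a → LexPos (b - a) := by
  have key : ∀ j ≤ m, ∃ L ⊆ K, IsCompact L ∧ L.Nonempty ∧
      (∀ a ∈ L, ∀ b ∈ L, ∀ i : Fin m, (i : ℕ) < j → a i = b i) ∧
      ∀ a ∈ L, ∀ b ∈ K, b ∉ L → LexPos (b - a) := by
    intro j
    induction j with
    | zero =>
      exact fun _ => ⟨K, subset_rfl, hK, hne, by simp, fun a _ b hb hb' => absurd hb hb'⟩
    | succ j ih =>
      intro hj
      obtain ⟨L, hLK, hL, hLne, heq, hlex⟩ := ih (by omega)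
      obtain ⟨a₀, ha₀, hmin⟩ := hL.exists_isMinOn hLne
        (continuous_apply (⟨j, by omega⟩ : Fin m)).continuousOn
      refine ⟨L ∩ {a | a ⟨j, by omega⟩ = a₀ ⟨j, by omega⟩}, fun a ha => hLK ha.1,
        hL.inter_right (isClosed_eq (continuous_apply _) continuous_const), ⟨a₀, ha₀, rfl⟩, ?_, ?_⟩
      · rintro a ⟨ha, ha'⟩ b ⟨hb, hb'⟩ i hi
        rcases Nat.lt_succ_iff_lt_or_eq.1 hi with h | h
        · exact heq a ha b hb i h
        · rw [show i = ⟨j, hj⟩ from Fin.ext h]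
          exact Eq.trans ha' (Eq.symm hb')
      · rintro a ⟨ha, ha'⟩ b hb hb'
        by_cases hbL : b ∈ L
        · refine ⟨⟨j, by omega⟩, fun i hi => ?_, ?_⟩
          · simp [heq b hbL a ha i hi]
          · have h1 : a₀ ⟨j, by omega⟩ ≤ b ⟨j, by omega⟩ := hmin hbL
            have h2 : b ⟨j, by omega⟩ ≠ a₀ ⟨j, by omega⟩ := fun h => hb' ⟨hbL, h⟩
            have h3 : a ⟨j, by omega⟩ = a₀ ⟨j, by omega⟩ := ha'
            simp only [Pi.sub_apply, h3, sub_pos]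
            exact lt_of_le_of_ne h1 h2.symm
        · exact hlex a ha b hb hbL
  obtain ⟨L, hLK, -, ⟨a, ha⟩, heq, hlex⟩ := key m le_rfl
  refine ⟨a, hLK ha, fun b hb hba => hlex a ha b hb fun hbL => hba ?_⟩
  exact funext fun i => heq b hbL a ha i i.2

/-- If the support of `b ≥ 0` is contained in that of `a ≥ 0`, a small multiple of `b` is
dominated by `a`. -/
lemma exists_pos_smul_le {ι : Type*} [Finite ι] {a b : ι → ℝ} (ha : 0 ≤ a)
    (hab : ∀ i, a i = 0 → b i = 0) : ∃ ε : ℝ, 0 < ε ∧ ε • b ≤ a := by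
  have h : ∀ i, ∀ᶠ ε : ℝ in nhdsWithin 0 (Set.Ioi 0), ε * b i ≤ a i := by
    intro i
    rcases (ha i).eq_or_lt with h0 | hpos
    · have h0' : a i = 0 := h0.symm
      simp [hab i h0', h0']
    · have hc : Filter.Tendsto (fun ε : ℝ => ε * b i) (nhdsWithin 0 (Set.Ioi 0)) (nhds 0) := by
        have : Continuous fun ε : ℝ => ε * b i := by fun_prop
        simpa using (this.tendsto 0).mono_left nhdsWithin_le_nhds
      exact (hc.eventually_lt_const hpos).mono fun _ h => h.le
  obtain ⟨ε, h1, h2⟩ := ((Filter.eventually_all.2 h).and self_mem_nhdsWithin).exists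
  exact ⟨ε, h2, h1⟩

/-- The image under `A` of the relatively open face `σ` of the nonnegative orthant. -/
def openCone {ι F : Type*} [AddCommGroup F] [Module ℝ F] (A : (ι → ℝ) →ₗ[ℝ] F) (σ : Finset ι) :
    Set F :=
  {y | ∃ a : ι → ℝ, (∀ i ∈ σ, 0 < a i) ∧ (∀ i ∉ σ, a i = 0) ∧ A a = y}

/-- `a` is the lexicographically least nonnegative vector in its fibre under `A`. -/
def IsLexMin {m : ℕ} {F : Type*} [AddCommGroup F] [Module ℝ F] (A : (Fin m → ℝ) →ₗ[ℝ] F)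
    (a : Fin m → ℝ) : Prop :=
  0 ≤ a ∧ ∀ b, 0 ≤ b → A b = A a → b ≠ a → LexPos (b - a)

section Triangulation

variable {m : ℕ} {F : Type*} [AddCommGroup F] [Module ℝ F] {A : (Fin m → ℝ) →ₗ[ℝ] F}

lemma IsLexMin.of_support_subset {a b : Fin m → ℝ} (ha : IsLexMin A a) (hb : 0 ≤ b)
    (hab : ∀ i, a i = 0 → b i = 0) : IsLexMin A b := by
  refine ⟨hb, fun c hc hcb hne => ?_⟩
  obtain ⟨ε, hε, hle⟩ := exists_pos_smul_le ha.1 hab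
  have h := ha.2 (a + ε • (c - b)) ?_ ?_ ?_
  · rw [add_sub_cancel_left] at h
    exact h.of_smul hε
  · intro i
    have h1 := hle i
    have h2 := mul_nonneg hε.le (hc i)
    simp only [Pi.smul_apply, smul_eq_mul, Pi.zero_apply, Pi.add_apply, Pi.sub_apply] at *
    linarith
  · simp [hcb]
  · simp [hε.ne', sub_eq_zero, hne]

lemma IsLexMin.eq_of_map_eq {a b : Fin m → ℝ} (ha : IsLexMin A a) (hb : IsLexMin A b)
    (h : A a = A b) : a = b := by
  by_contra hne
  have h1 := ha.2 b hb.1 h.symm (Ne.symm hne)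
  have h2 := hb.2 a ha.1 h hne
  rw [← neg_sub] at h2
  exact h1.not_neg h2

lemma IsLexMin.eq_zero_of_map_eq_zero {a c : Fin m → ℝ} (ha : IsLexMin A a)
    (hc : ∀ i, a i = 0 → c i = 0) (h : A c = 0) : c = 0 := by
  have h1 : IsLexMin A (c⁺) := ha.of_support_subset (posPart_nonneg c) fun i hi => by
    simp [hc i hi]
  have h2 : IsLexMin A (c⁻) := ha.of_support_subset (negPart_nonneg c) fun i hi => by
    simp [hc i hi]
  have h3 : A (c⁺) = A (c⁻) := by
    rw [← sub_eq_zero, ← map_sub, posPart_sub_negPart, h]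
  rw [← posPart_sub_negPart c, h1.eq_of_map_eq h2 h3, sub_self]

/-- An open polyhedral cone is a disjoint union of open simplicial cones spanned by some of its
generators. -/
theorem exists_triangulation (A : (Fin m → ℝ) →ₗ[ℝ] F)
    (hA : ∀ y, IsCompact {a : Fin m → ℝ | 0 ≤ a ∧ A a = y}) :
    ∃ T : Finset (Finset (Fin m)),
      (∀ σ ∈ T, ∀ c : Fin m → ℝ, (∀ i ∉ σ, c i = 0) → A c = 0 → c = 0) ∧
      (∀ σ ∈ T, ∀ τ ∈ T, σ ≠ τ → Disjoint (openCone A σ) (openCone A τ)) ∧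
      openCone A Finset.univ = ⋃ σ ∈ T, openCone A σ := by
  classical
  have hnn : ∀ {σ : Finset (Fin m)} {a : Fin m → ℝ}, (∀ i ∈ σ, 0 < a i) → (∀ i ∉ σ, a i = 0) →
      0 ≤ a := by
    intro σ a h1 h2 i
    by_cases hi : i ∈ σ
    · exact (h1 i hi).le
    · exact (h2 i hi).ge
  let T : Finset (Finset (Fin m)) := Finset.univ.filter fun σ => ∃ a, IsLexMin A a ∧
    (∀ i ∈ σ, 0 < a i) ∧ (∀ i ∉ σ, a i = 0) ∧ A a ∈ openCone A Finset.univ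
  have hT : ∀ σ, σ ∈ T ↔ ∃ a, IsLexMin A a ∧ (∀ i ∈ σ, 0 < a i) ∧ (∀ i ∉ σ, a i = 0) ∧
      A a ∈ openCone A Finset.univ := by simp [T]
  have hsupp : ∀ {σ : Finset (Fin m)} {a c : Fin m → ℝ}, (∀ i ∈ σ, 0 < a i) →
      (∀ i ∉ σ, c i = 0) → ∀ i, a i = 0 → c i = 0 := by
    intro σ a c h1 h2 i hi
    exact h2 i fun his => (h1 i his).ne' hi
  refine ⟨T, ?_, ?_, ?_⟩
  · intro σ hσ c hc h
    obtain ⟨a, ha, hpos, -, -⟩ := (hT σ).1 hσ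
    exact ha.eq_zero_of_map_eq_zero (hsupp hpos hc) h
  · intro σ hσ τ hτ hne
    obtain ⟨a, ha, hpos, -, -⟩ := (hT σ).1 hσ
    obtain ⟨b, hb, hpos', -, -⟩ := (hT τ).1 hτ
    rw [Set.disjoint_left]
    rintro y ⟨a', h1, h2, h3⟩ ⟨b', h1', h2', h3'⟩
    obtain rfl := (ha.of_support_subset (hnn h1 h2) (hsupp hpos h2)).eq_of_map_eq
      (hb.of_support_subset (hnn h1' h2') (hsupp hpos' h2')) (h3.trans h3'.symm)
    refine hne (Finset.ext fun i => ⟨fun hi => ?_, fun hi => ?_⟩)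
    · by_contra hi'
      exact (h1 i hi).ne' (h2' i hi')
    · by_contra hi'
      exact (h1' i hi).ne' (h2 i hi')
  · ext y
    simp only [Set.mem_iUnion, exists_prop]
    constructor
    · intro hy
      obtain ⟨c, hc1, hc2, hc3⟩ := hy
      obtain ⟨a, ⟨ha0, hay⟩, hmin⟩ := (hA y).exists_lexMin ⟨c, hnn hc1 hc2, hc3⟩
      have hpos : ∀ i ∈ Finset.univ.filter (fun i => 0 < a i), 0 < a i := by simp
      have hzero : ∀ i ∉ Finset.univ.filter (fun i => 0 < a i), a i = 0 := by
        intro i hi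
        simp only [Finset.mem_filter, Finset.mem_univ, true_and, not_lt] at hi
        exact le_antisymm hi (ha0 i)
      refine ⟨Finset.univ.filter fun i => 0 < a i, (hT _).2 ⟨a, ?_, hpos, hzero, ?_⟩,
        a, hpos, hzero, hay⟩
      · exact ⟨ha0, fun b hb hba => hmin b ⟨hb, hba.trans hay⟩⟩
      · exact ⟨c, hc1, hc2, hc3.trans hay.symm⟩
    · rintro ⟨σ, hσ, b, hb1, hb2, hb3⟩
      obtain ⟨a, -, ha1, ha2, c, hc1, -, hc3⟩ := (hT σ).1 hσ
      obtain ⟨ε, hε, hle⟩ := exists_pos_smul_le (hnn hb1 hb2) (hsupp hb1 ha2)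
      refine ⟨b + ε • (c - a), fun i hi => ?_, by simp, by simp [hc3, hb3]⟩
      have h1 := hle i
      have h2 := mul_pos hε (hc1 i hi)
      simp only [Pi.smul_apply, smul_eq_mul, Pi.add_apply, Pi.sub_apply] at *
      linarith

end Triangulation

section RelativeInterior

variable {E : Type*} [NormedAddCommGroup E] [NormedSpace ℝ E]

lemma mem_intrinsicInterior_iff_nhdsWithin {s : Set E} {x : E} :
    x ∈ intrinsicInterior ℝ s ↔
      x ∈ affineSpan ℝ s ∧ s ∈ nhdsWithin x (affineSpan ℝ s : Set E) := by
  rw [mem_intrinsicInterior]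
  constructor
  · rintro ⟨y, hy, rfl⟩
    refine ⟨y.2, ?_⟩
    rw [mem_interior_iff_mem_nhds] at hy
    exact preimage_coe_mem_nhds_subtype.1 hy
  · rintro ⟨hx, h⟩
    refine ⟨⟨x, hx⟩, ?_, rfl⟩
    rw [mem_interior_iff_mem_nhds]
    exact preimage_coe_mem_nhds_subtype.2 h

/-- A point of the relative interior can be moved a little away from any point of the affine
span. -/
lemma exists_lineMap_mem_of_mem_intrinsicInterior {s : Set E} {x b : E}
    (hx : x ∈ intrinsicInterior ℝ s) (hb : b ∈ affineSpan ℝ s) :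
    ∃ ε : ℝ, 0 < ε ∧ AffineMap.lineMap x b (-ε) ∈ s := by
  rw [mem_intrinsicInterior_iff_nhdsWithin] at hx
  have hc : Continuous fun ε : ℝ => (AffineMap.lineMap x b (-ε) : E) := by
    simp only [AffineMap.lineMap_apply_module]
    fun_prop
  have ht : Filter.Tendsto (fun ε : ℝ => (AffineMap.lineMap x b (-ε) : E))
      (nhdsWithin 0 (Set.Ioi 0)) (nhdsWithin x (affineSpan ℝ s : Set E)) := by
    refine tendsto_nhdsWithin_iff.2 ⟨?_, Filter.Eventually.of_forall fun ε =>
      AffineMap.lineMap_mem _ hx.1 hb⟩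
    simpa using (hc.tendsto 0).mono_left nhdsWithin_le_nhds
  obtain ⟨ε, h1, h2⟩ := ((ht.eventually hx.2).and self_mem_nhdsWithin).exists
  exact ⟨ε, h2, h1⟩

lemma Convex.lineMap_mem_intrinsicInterior {s : Set E} (hs : Convex ℝ s) {x z : E}
    (hx : x ∈ intrinsicInterior ℝ s) (hz : z ∈ s) {t : ℝ} (ht : t ∈ Set.Ioc (0 : ℝ) 1) :
    AffineMap.lineMap z x t ∈ intrinsicInterior ℝ s := by
  rw [mem_intrinsicInterior_iff_nhdsWithin] at hx ⊢
  have hzs := subset_affineSpan ℝ s hz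
  refine ⟨AffineMap.lineMap_mem _ hzs hx.1, ?_⟩
  have hc : Continuous fun y : E => (AffineMap.lineMap z y t⁻¹ : E) := by
    simp only [AffineMap.lineMap_apply_module]
    fun_prop
  have hinv : ∀ y : E, AffineMap.lineMap z (AffineMap.lineMap z y t) t⁻¹ = y := fun y => by
    simp [ht.1.ne']
  have hinv' : ∀ y : E, AffineMap.lineMap z (AffineMap.lineMap z y t⁻¹) t = y := fun y => by
    simp [ht.1.ne']
  have htend : Filter.Tendsto (fun y : E => (AffineMap.lineMap z y t⁻¹ : E))
      (nhdsWithin (AffineMap.lineMap z x t) (affineSpan ℝ s : Set E))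
      (nhdsWithin x (affineSpan ℝ s : Set E)) := by
    refine tendsto_nhdsWithin_iff.2 ⟨?_, ?_⟩
    · have := hc.tendsto (AffineMap.lineMap z x t)
      rw [hinv] at this
      exact this.mono_left nhdsWithin_le_nhds
    · filter_upwards [self_mem_nhdsWithin] with y hy
      exact AffineMap.lineMap_mem _ hzs hy
  filter_upwards [htend hx.2] with y hy
  rw [← hinv' y]
  exact hs.lineMap_mem hz hy ⟨ht.1.le, ht.2⟩

lemma mem_convexHull_range_iff {ι : Type*} [Fintype ι] {p : ι → E} {x : E} :
    x ∈ convexHull ℝ (Set.range p) ↔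
      ∃ a : ι → ℝ, (∀ i, 0 ≤ a i) ∧ ∑ i, a i = 1 ∧ ∑ i, a i • p i = x := by
  classical
  constructor
  · intro hx
    have h : Convex ℝ {x : E | ∃ a : ι → ℝ, (∀ i, 0 ≤ a i) ∧ ∑ i, a i = 1 ∧
        ∑ i, a i • p i = x} := by
      rintro _ ⟨a, ha, ha1, rfl⟩ _ ⟨b, hb, hb1, rfl⟩ s t hs ht hst
      refine ⟨s • a + t • b, fun i => ?_, ?_, ?_⟩
      · have := mul_nonneg hs (ha i)
        have := mul_nonneg ht (hb i)
        simp only [Pi.add_apply, Pi.smul_apply, smul_eq_mul]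
        linarith
      · simp [Finset.sum_add_distrib, ← Finset.mul_sum, ha1, hb1, hst]
      · simp [Finset.sum_add_distrib, add_smul, Finset.smul_sum, mul_smul]
    refine convexHull_min ?_ h hx
    rintro _ ⟨i, rfl⟩
    refine ⟨Pi.single i 1, fun j => ?_, by simp, ?_⟩
    · by_cases hj : j = i <;> simp [hj]
    · simp [Pi.single_apply, ite_smul]
  · rintro ⟨a, ha, ha1, hx⟩
    exact mem_convexHull_of_exists_fintype a p ha ha1 (fun i => ⟨i, rfl⟩) hx

/-- The relative interior of the convex hull of finitely many points consists of the convex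
combinations with strictly positive coefficients. -/
theorem mem_intrinsicInterior_convexHull_range_iff [FiniteDimensional ℝ E] {ι : Type*} [Fintype ι]
    {p : ι → E} {x : E} :
    x ∈ intrinsicInterior ℝ (convexHull ℝ (Set.range p)) ↔
      ∃ a : ι → ℝ, (∀ i, 0 < a i) ∧ ∑ i, a i = 1 ∧ ∑ i, a i • p i = x := by
  constructor
  · intro hx
    have hne : Nonempty ι := by
      have := convexHull_nonempty_iff.1 ⟨x, intrinsicInterior_subset hx⟩
      exact Set.range_nonempty_iff_nonempty.1 this
    have hcard : (0 : ℝ) < Fintype.card ι := by exact_mod_cast Fintype.card_pos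
    let b : E := ∑ i : ι, (Fintype.card ι : ℝ)⁻¹ • p i
    have hb : b ∈ convexHull ℝ (Set.range p) :=
      mem_convexHull_range_iff.2 ⟨fun _ => (Fintype.card ι : ℝ)⁻¹,
        fun _ => (inv_pos.2 hcard).le, by simp [hcard.ne'], rfl⟩
    obtain ⟨ε, hε, hz⟩ :=
      exists_lineMap_mem_of_mem_intrinsicInterior hx (subset_affineSpan ℝ _ hb)
    obtain ⟨a, ha, ha1, haz⟩ := mem_convexHull_range_iff.1 hz
    have hε1 : (1 + ε) ≠ 0 := by positivity
    refine ⟨fun i => (1 + ε)⁻¹ * (a i + ε * (Fintype.card ι : ℝ)⁻¹), fun i => ?_, ?_, ?_⟩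
    · have := ha i
      positivity
    · rw [← Finset.mul_sum, Finset.sum_add_distrib, ha1]
      simp only [Finset.sum_const, Finset.card_univ, nsmul_eq_mul]
      field_simp
    · simp only [mul_smul, add_smul]
      rw [← Finset.smul_sum, Finset.sum_add_distrib, haz, ← Finset.smul_sum,
        AffineMap.lineMap_apply_module, inv_smul_eq_iff₀ hε1]
      change _ + ε • b = _
      module
  · rintro ⟨a, ha, ha1, rfl⟩
    have hP : (convexHull ℝ (Set.range p)).Nonempty :=
      ⟨_, mem_convexHull_range_iff.2 ⟨a, fun i => (ha i).le, ha1, rfl⟩⟩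
    obtain ⟨x, hx⟩ := hP.intrinsicInterior (convex_convexHull ℝ _)
    obtain ⟨b, hb, hb1, rfl⟩ := mem_convexHull_range_iff.1 (intrinsicInterior_subset hx)
    obtain ⟨ε, hε, hle⟩ := exists_pos_smul_le (a := a) (b := b) (fun i => (ha i).le)
      fun i hi => absurd hi (ha i).ne'
    have hz : AffineMap.lineMap (∑ i, a i • p i) (∑ i, b i • p i) (-ε) ∈
        convexHull ℝ (Set.range p) := by
      refine mem_convexHull_range_iff.2 ⟨(1 + ε) • a - ε • b, fun i => ?_, ?_, ?_⟩
      · have h1 := hle i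
        have h2 := mul_pos hε (ha i)
        simp only [Pi.smul_apply, smul_eq_mul, Pi.sub_apply] at *
        linarith
      · simp [Finset.sum_sub_distrib, ← Finset.mul_sum, ha1, hb1]
      · simp only [Pi.smul_apply, smul_eq_mul, Pi.sub_apply, sub_smul, mul_smul,
          Finset.sum_sub_distrib, ← Finset.smul_sum, AffineMap.lineMap_apply_module]
        module
    have h := (convex_convexHull ℝ _).lineMap_mem_intrinsicInterior hx hz
      (t := ε / (1 + ε)) ⟨by positivity, by rw [div_le_one (by positivity)]; linarith⟩
    convert h using 1
    rw [AffineMap.lineMap_apply_module, AffineMap.lineMap_apply_module]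
    have hε1 : (1 + ε) ≠ 0 := by positivity
    match_scalars <;> field_simp <;> ring

end RelativeInterior

section Counting

/-- The counting function of the family `S` is a nonnegative integral combination of the
binomial coefficients `binomial (k-1) i` with `i ≤ d`. -/
def HasFStar {α : Type*} (d : ℕ) (S : ℕ → Set α) : Prop :=
  ∃ f : ℕ → ℕ, ∀ k, 1 ≤ k → (S k).Finite ∧
    (S k).ncard = ∑ i ∈ Finset.range (d + 1), f i * (k - 1).choose i

lemma HasFStar.congr {α : Type*} {d : ℕ} {S S' : ℕ → Set α} (h : HasFStar d S)
    (hS : ∀ k, 1 ≤ k → S' k = S k) : HasFStar d S' := by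
  obtain ⟨f, hf⟩ := h
  exact ⟨f, fun k hk => by rw [hS k hk]; exact hf k hk⟩

lemma HasFStar.biUnion {α τ : Type*} {d : ℕ} (T : Finset τ) (S : τ → ℕ → Set α)
    (hdisj : ∀ s ∈ T, ∀ t ∈ T, s ≠ t → ∀ k, 1 ≤ k → Disjoint (S s k) (S t k))
    (hS : ∀ t ∈ T, HasFStar d (S t)) : HasFStar d fun k => ⋃ t ∈ T, S t k := by
  classical
  induction T using Finset.induction_on with
  | empty => exact ⟨0, fun k _ => by simp⟩
  | insert t T ht ih =>
    obtain ⟨f, hf⟩ := hS t (Finset.mem_insert_self t T)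
    obtain ⟨g, hg⟩ := ih
      (fun s hs t ht => hdisj s (Finset.mem_insert_of_mem hs) t (Finset.mem_insert_of_mem ht))
      fun s hs => hS s (Finset.mem_insert_of_mem hs)
    refine ⟨f + g, fun k hk => ?_⟩
    obtain ⟨hf1, hf2⟩ := hf k hk
    obtain ⟨hg1, hg2⟩ := hg k hk
    have hd : Disjoint (S t k) (⋃ s ∈ T, S s k) := by
      simp only [Set.disjoint_iUnion_right]
      intro s hs
      exact hdisj t (Finset.mem_insert_self t T) s (Finset.mem_insert_of_mem hs)
        (fun h => ht (h ▸ hs)) k hk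
    simp only [Finset.set_biUnion_insert]
    refine ⟨hf1.union hg1, ?_⟩
    rw [Set.ncard_union_eq hd hf1 hg1, hf2, hg2, ← Finset.sum_add_distrib]
    simp [add_mul]

/-- Stars and bars in the shifted form needed for box points at height `h`. -/
lemma ncard_sum_add_eq {κ : Type*} [Fintype κ] {m h k : ℕ} (hκ : Fintype.card κ = m + 1)
    (hk : 1 ≤ k) (hh : h ≤ m + 1) :
    {P : κ → ℕ | ∑ i, P i + h = k}.ncard =
      ∑ i ∈ Finset.range (m + 1), (m + 1 - h).choose (m - i) * (k - 1).choose i := by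
  classical
  have hV : ∑ i ∈ Finset.range (m + 1), (m + 1 - h).choose (m - i) * (k - 1).choose i =
      (k + m - h).choose m := by
    rw [show k + m - h = (k - 1) + (m + 1 - h) by omega, Nat.add_choose_eq,
      Finset.Nat.sum_antidiagonal_eq_sum_range_succ_mk]
    exact Finset.sum_congr rfl fun i _ => mul_comm _ _
  rw [hV]
  by_cases hhk : h ≤ k
  · have hset : {P : κ → ℕ | ∑ i, P i + h = k} = {P : κ → ℕ | ∑ i, P i = k - h} := by
      ext P
      simp only [Set.mem_ofPred_eq]
      omega
    have hcard : Nat.card {P : κ → ℕ | ∑ i, P i = k - h} = Nat.card (Sym κ (k - h)) :=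
      Nat.card_congr (Sym.equivNatSumOfFintype κ (k - h)).symm
    rw [hset, ← Nat.card_coe_set_eq, hcard, Nat.card_eq_fintype_card,
      Sym.card_sym_eq_choose, hκ, show m + 1 + (k - h) - 1 = (k - h) + m by omega,
      Nat.choose_symm_add, show k - h + m = k + m - h by omega]
  · have hset : {P : κ → ℕ | ∑ i, P i + h = k} = ∅ := by
      ext P
      simp only [Set.mem_ofPred_eq, Set.mem_empty_iff_false, iff_false]
      omega
    rw [hset, Set.ncard_empty, Nat.choose_eq_zero_of_lt (by omega)]

/-- Lattice points in the dilates of an open lattice simplex. -/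
theorem hasFStar_openSimplex {n d : ℕ} {κ : Type*} [Fintype κ] (w : κ → Fin n → ℤ)
    (hw : ∀ c : κ → ℝ, ∑ i, c i = 0 → (∀ j, ∑ i, c i * (w i j : ℝ) = 0) → c = 0)
    (hd : Fintype.card κ ≤ d + 1) :
    HasFStar d fun k => {z : Fin n → ℤ | ∃ a : κ → ℝ, (∀ i, 0 < a i) ∧ ∑ i, a i = k ∧
      ∀ j, ∑ i, a i * (w i j : ℝ) = z j} := by
  classical
  rcases Nat.eq_zero_or_pos (Fintype.card κ) with h0 | hpos
  · have := Fintype.card_eq_zero_iff.1 h0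
    refine ⟨0, fun k hk => ?_⟩
    have hset : {z : Fin n → ℤ | ∃ a : κ → ℝ, (∀ i, 0 < a i) ∧ ∑ i, a i = k ∧
        ∀ j, ∑ i, a i * (w i j : ℝ) = z j} = ∅ := by
      ext z
      simp only [Finset.univ_eq_empty, Finset.sum_empty, Set.mem_ofPred_eq, Set.mem_empty_iff_false,
        iff_false]
      rintro ⟨a, -, h, -⟩
      have : k = 0 := by exact_mod_cast h.symm
      omega
    simp only [hset]
    simp
  obtain ⟨m, hm⟩ : ∃ m, Fintype.card κ = m + 1 := ⟨_, (Nat.succ_pred_eq_of_pos hpos).symm⟩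
  let Box : Set ((Fin n → ℤ) × ℕ) := {q | ∃ b : κ → ℝ, (∀ i, 0 < b i ∧ b i ≤ 1) ∧
    ∑ i, b i = q.2 ∧ ∀ j, ∑ i, b i * (w i j : ℝ) = q.1 j}
  have hBoxle : ∀ q ∈ Box, q.2 ≤ m + 1 := by
    rintro q ⟨b, hb, hb1, -⟩
    have h2 : ∑ i, b i ≤ ∑ i : κ, (1 : ℝ) := Finset.sum_le_sum fun i _ => (hb i).2
    rw [hb1] at h2
    rw [Finset.sum_const, Finset.card_univ, hm, nsmul_eq_mul, mul_one] at h2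
    exact_mod_cast h2
  have hBoxfin : Box.Finite := by
    let M : Fin n → ℤ := fun j => ∑ i, |w i j|
    refine ((Set.finite_Icc (-M) M).prod (Set.finite_Iic (m + 1))).subset fun q hq => ?_
    refine ⟨?_, hBoxle q hq⟩
    obtain ⟨b, hb, -, hb2⟩ := hq
    have habs : ∀ j, |q.1 j| ≤ M j := by
      intro j
      have h : |∑ i, b i * (w i j : ℝ)| ≤ ∑ i, |(w i j : ℝ)| := by
        refine (Finset.abs_sum_le_sum_abs _ _).trans (Finset.sum_le_sum fun i _ => ?_)
        rw [abs_mul, abs_of_pos (hb i).1]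
        exact mul_le_of_le_one_left (abs_nonneg _) (hb i).2
      rw [hb2] at h
      exact_mod_cast h
    exact ⟨fun j => (abs_le.1 (habs j)).1, fun j => (abs_le.1 (habs j)).2⟩
  refine ⟨fun i => if i ≤ m then
    ∑ q ∈ hBoxfin.toFinset, (m + 1 - q.2).choose (m - i) else 0, fun k hk => ?_⟩
  have hPfin : ∀ h : ℕ, {P : κ → ℕ | ∑ i, P i + h = k}.Finite := by
    intro h
    refine (Set.finite_Iic (fun _ : κ => k)).subset fun P hP i => ?_
    have h1 : P i ≤ ∑ i, P i := Finset.single_le_sum (fun _ _ => Nat.zero_le _) (Finset.mem_univ i)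
    have h2 : ∑ i, P i + h = k := hP
    change P i ≤ k
    omega
  let D : Finset (Σ _ : (Fin n → ℤ) × ℕ, κ → ℕ) :=
    hBoxfin.toFinset.sigma fun q => (hPfin q.2).toFinset
  let g : (Σ _ : (Fin n → ℤ) × ℕ, κ → ℕ) → Fin n → ℤ :=
    fun x j => x.1.1 j + ∑ i, (x.2 i : ℤ) * w i j
  have hD : ∀ q P, (⟨q, P⟩ : Σ _ : (Fin n → ℤ) × ℕ, κ → ℕ) ∈ D ↔
      q ∈ Box ∧ ∑ i, P i + q.2 = k := by simp [D]
  have hset : {z : Fin n → ℤ | ∃ a : κ → ℝ, (∀ i, 0 < a i) ∧ ∑ i, a i = k ∧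
      ∀ j, ∑ i, a i * (w i j : ℝ) = z j} = g '' D := by
    ext z
    constructor
    · rintro ⟨a, ha, hak, haz⟩
      let P : κ → ℕ := fun i => ⌈a i⌉₊ - 1
      have hP : ∀ i, (P i : ℝ) = ⌈a i⌉₊ - 1 := fun i => by
        have : 1 ≤ ⌈a i⌉₊ := Nat.one_le_ceil_iff.2 (ha i)
        simp [P, Nat.cast_sub this]
      have hPlt : ∀ i, (P i : ℝ) < a i := fun i => by
        have := Nat.ceil_lt_add_one (ha i).le
        rw [hP]
        linarith
      have hPle : ∀ i, a i ≤ P i + 1 := fun i => by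
        have := Nat.le_ceil (a i)
        rw [hP]
        linarith
      have hPk : ∑ i, P i ≤ k := by
        have : (∑ i, (P i : ℝ)) ≤ k := hak ▸ Finset.sum_le_sum fun i _ => (hPlt i).le
        exact_mod_cast this
      refine ⟨⟨(fun j => z j - ∑ i, (P i : ℤ) * w i j, k - ∑ i, P i), P⟩, (hD _ _).2 ⟨?_, ?_⟩, ?_⟩
      · refine ⟨fun i => a i - P i, fun i => ⟨by linarith [hPlt i], by linarith [hPle i]⟩, ?_, ?_⟩
        · rw [Finset.sum_sub_distrib, hak, Nat.cast_sub hPk]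
          push_cast
          rfl
        · intro j
          simp only [sub_mul, Finset.sum_sub_distrib, haz]
          push_cast
          rfl
      · change _ + (k - _) = k
        omega
      · funext j
        simp [g]
    · rintro ⟨⟨q, P⟩, hqP, rfl⟩
      obtain ⟨⟨b, hb, hb1, hb2⟩, hPk⟩ := (hD _ _).1 hqP
      refine ⟨fun i => b i + P i, fun i => ?_, ?_, fun j => ?_⟩
      · have := (hb i).1
        positivity
      · rw [Finset.sum_add_distrib, hb1, ← hPk]
        push_cast
        ring
      · simp only [add_mul, Finset.sum_add_distrib, hb2]
        simp [g]
  have hinj : Set.InjOn g D := by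
    rintro ⟨⟨y, h⟩, P⟩ hx ⟨⟨y', h'⟩, P'⟩ hx' hg
    obtain ⟨⟨b, hb, hb1, hb2⟩, hPk⟩ := (hD _ _).1 hx
    obtain ⟨⟨b', hb', hb1', hb2'⟩, hPk'⟩ := (hD _ _).1 hx'
    have hgj : ∀ j, y j + ∑ i, (P i : ℤ) * w i j = y' j + ∑ i, (P' i : ℤ) * w i j :=
      fun j => congrFun hg j
    have hc := hw (fun i => b i + P i - (b' i + P' i)) ?_ ?_
    · have hPP : P = P' := by
        funext i
        have hi := congrFun hc i
        simp only [Pi.zero_apply] at hi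
        have h1 : (P i : ℝ) < P' i + 1 := by linarith [(hb i).1, (hb' i).2]
        have h2 : (P' i : ℝ) < P i + 1 := by linarith [(hb' i).1, (hb i).2]
        have h1' : P i < P' i + 1 := by exact_mod_cast h1
        have h2' : P' i < P i + 1 := by exact_mod_cast h2
        omega
      subst hPP
      have hh : h = h' := by
        simp only at hPk hPk'
        omega
      have hy : y = y' := funext fun j => by simpa using hgj j
      rw [hh, hy]
    · simp only [Finset.sum_sub_distrib, Finset.sum_add_distrib, hb1, hb1']
      have e1 : (∑ i, (P i : ℝ)) + h = k := by exact_mod_cast hPk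
      have e2 : (∑ i, (P' i : ℝ)) + h' = k := by exact_mod_cast hPk'
      linarith
    · intro j
      simp only [sub_mul, add_mul, Finset.sum_sub_distrib, Finset.sum_add_distrib, hb2, hb2']
      have e : (y j : ℝ) + ∑ i, (P i : ℝ) * w i j = y' j + ∑ i, (P' i : ℝ) * w i j := by
        exact_mod_cast hgj j
      linarith
  simp only [hset]
  refine ⟨D.finite_toSet.image g, ?_⟩
  rw [hinj.ncard_image, Set.ncard_coe_finset, Finset.card_sigma]
  have hcard : ∀ q ∈ hBoxfin.toFinset, (hPfin q.2).toFinset.card =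
      ∑ i ∈ Finset.range (m + 1), (m + 1 - q.2).choose (m - i) * (k - 1).choose i := by
    intro q hq
    have hq' := hBoxle q (hBoxfin.mem_toFinset.1 hq)
    rw [← Set.ncard_eq_toFinset_card _ (hPfin q.2), ncard_sum_add_eq hm hk hq']
  rw [Finset.sum_congr rfl hcard, Finset.sum_comm]
  have hsub : Finset.range (m + 1) ⊆ Finset.range (d + 1) :=
    Finset.range_subset_range.2 (by omega)
  rw [← Finset.sum_subset hsub]
  · refine Finset.sum_congr rfl fun i hi => ?_
    rw [if_pos (by simpa [Nat.lt_succ_iff] using hi), Finset.sum_mul]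
  · intro i _ hi
    rw [if_neg (by simpa [Nat.lt_succ_iff] using hi), zero_mul]

end Counting

section Polytope

/-- The linear map sending a weight vector to its weighted sum of the `p i` together with its
total weight. -/
noncomputable def homogenizedCombination {n m : ℕ} (p : Fin m → Fin n → ℝ) :
    (Fin m → ℝ) →ₗ[ℝ] (Fin n → ℝ) × ℝ :=
  (Fintype.linearCombination ℝ p).prod (Fintype.linearCombination ℝ fun _ => (1 : ℝ))

lemma homogenizedCombination_apply {n m : ℕ} (p : Fin m → Fin n → ℝ) (a : Fin m → ℝ) :
    homogenizedCombination p a = (∑ i, a i • p i, ∑ i, a i) := by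
  simp [homogenizedCombination, Fintype.linearCombination_apply]

lemma isCompact_homogenizedCombination_fiber {n m : ℕ} (p : Fin m → Fin n → ℝ)
    (y : (Fin n → ℝ) × ℝ) :
    IsCompact {a : Fin m → ℝ | 0 ≤ a ∧ homogenizedCombination p a = y} := by
  refine (isCompact_Icc (a := (0 : Fin m → ℝ)) (b := fun _ => y.2)).of_isClosed_subset ?_ ?_
  · exact isClosed_Ici.inter
      (isClosed_eq (homogenizedCombination p).continuous_of_finiteDimensional continuous_const)
  · rintro a ⟨ha, rfl⟩
    refine ⟨ha, fun i => ?_⟩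
    rw [homogenizedCombination_apply]
    exact Finset.single_le_sum (fun i _ => ha i) (Finset.mem_univ i)

lemma homogenizedCombination_extend {n m : ℕ} (p : Fin m → Fin n → ℝ) (σ : Finset (Fin m))
    (c : σ → ℝ) : homogenizedCombination p (fun i => if hi : i ∈ σ then c ⟨i, hi⟩ else 0) =
      (∑ i : σ, c i • p i, ∑ i : σ, c i) := by
  rw [homogenizedCombination_apply, ← Finset.sum_subset (Finset.subset_univ σ),
    ← Finset.sum_subset (Finset.subset_univ σ), ← Finset.sum_coe_sort σ, ← Finset.sum_coe_sort σ]
  · simp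
  all_goals
    intro i _ hi
    simp [hi]

lemma card_le_of_affine_independent {n d m : ℕ} {p : Fin m → Fin n → ℝ} {σ : Finset (Fin m)}
    (hσ : ∀ c : Fin m → ℝ, (∀ i ∉ σ, c i = 0) → homogenizedCombination p c = 0 → c = 0)
    (hd : Module.finrank ℝ (vectorSpan ℝ (Set.range p)) ≤ d) : Fintype.card σ ≤ d + 1 := by
  classical
  have haff : AffineIndependent ℝ fun i : σ => p i := by
    rw [affineIndependent_iff_of_fintype]
    intro c hc0 hc i
    rw [Finset.univ.weightedVSub_eq_linear_combination hc0] at hc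
    have h := hσ (fun i => if hi : i ∈ σ then c ⟨i, hi⟩ else 0) (fun i hi => by simp [hi]) ?_
    · simpa using congrFun h i
    · rw [homogenizedCombination_extend, hc0, hc]
      rfl
  rcases isEmpty_or_nonempty σ with hE | hne
  · simp [Fintype.card_eq_zero]
  · rw [← haff.finrank_vectorSpan_add_one]
    have hle : vectorSpan ℝ (Set.range fun i : σ => p i) ≤ vectorSpan ℝ (Set.range p) :=
      vectorSpan_mono ℝ (Set.range_comp_subset_range (fun i : σ => (i : Fin m)) p)
    have := Submodule.finrank_mono hle
    omega

/-- Lattice points in the dilates of a relatively open lattice polytope. -/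
theorem hasFStar_openLatticePolytope {n d : ℕ} (V : Finset (Fin n → ℤ))
    (hd : Module.finrank ℝ
      (vectorSpan ℝ ((fun z : Fin n → ℤ => fun j => ((z j : ℝ))) '' V)) ≤ d) :
    HasFStar d fun k => {z : Fin n → ℤ | ((fun j => ((z j : ℝ))) : Fin n → ℝ) ∈
      ((k : ℝ) • openLatticePolytope n V : Set (Fin n → ℝ))} := by
  classical
  let v : Fin V.card → Fin n → ℤ := fun i => (V.equivFin.symm i : Fin n → ℤ)
  let p : Fin V.card → Fin n → ℝ := fun i j => (v i j : ℝ)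
  have hrange : (fun z : Fin n → ℤ => fun j => ((z j : ℝ))) '' V = Set.range p := by
    have : (V : Set (Fin n → ℤ)) = Set.range v := by
      rw [show v = Subtype.val ∘ V.equivFin.symm from rfl, V.equivFin.symm.surjective.range_comp]
      simp
    rw [this, ← Set.range_comp]
    rfl
  rw [hrange] at hd
  obtain ⟨T, hTind, hTdisj, hTcover⟩ :=
    exists_triangulation (homogenizedCombination p) (isCompact_homogenizedCombination_fiber p)
  have hmem : ∀ k : ℕ, 1 ≤ k → ∀ x : Fin n → ℝ,
      x ∈ ((k : ℝ) • openLatticePolytope n V : Set (Fin n → ℝ)) ↔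
        (x, (k : ℝ)) ∈ openCone (homogenizedCombination p) Finset.univ := by
    intro k hk x
    have hk0 : (0 : ℝ) < k := by exact_mod_cast hk
    rw [Set.mem_smul_set_iff_inv_smul_mem₀ hk0.ne', openLatticePolytope, hrange,
      mem_intrinsicInterior_convexHull_range_iff]
    constructor
    · rintro ⟨a, ha, ha1, hax⟩
      refine ⟨(k : ℝ) • a, fun i _ => mul_pos hk0 (ha i), by simp, ?_⟩
      rw [map_smul, homogenizedCombination_apply, ha1, hax, Prod.smul_mk, smul_inv_smul₀ hk0.ne']
      simp
    · rintro ⟨a, ha, -, hax⟩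
      rw [homogenizedCombination_apply, Prod.mk.injEq] at hax
      refine ⟨fun i => (k : ℝ)⁻¹ * a i, fun i => mul_pos (inv_pos.2 hk0) (ha i (by simp)), ?_, ?_⟩
      · rw [← Finset.mul_sum, hax.2, inv_mul_cancel₀ hk0.ne']
      · simp only [mul_smul]
        rw [← Finset.smul_sum, hax.1]
  have hcells := HasFStar.biUnion (d := d) T (fun σ k => {z : Fin n → ℤ |
      (((fun j => ((z j : ℝ))) : Fin n → ℝ), (k : ℝ)) ∈ openCone (homogenizedCombination p) σ})
    ?_ ?_
  · refine hcells.congr fun k hk => ?_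
    ext z
    simp only [Set.mem_ofPred_eq, hmem k hk, hTcover, Set.mem_iUnion]
  · intro σ hσ τ hτ hne k _
    rw [Set.disjoint_left]
    intro z hz hz'
    exact Set.disjoint_left.1 (hTdisj σ hσ τ hτ hne) hz hz'
  · intro σ hσ
    refine (hasFStar_openSimplex (d := d) (fun i : σ => v i) ?_
      (card_le_of_affine_independent (hTind σ hσ) hd)).congr fun k _ => ?_
    · intro c hc0 hc
      have h := hTind σ hσ (fun i => if hi : i ∈ σ then c ⟨i, hi⟩ else 0)
        (fun i hi => by simp [hi]) ?_
      · funext i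
        simpa using congrFun h i
      · rw [homogenizedCombination_extend, hc0, Prod.mk_eq_zero]
        refine ⟨funext fun j => ?_, rfl⟩
        simpa [p] using hc j
    · ext z
      constructor
      · rintro ⟨a, ha, ha0, haz⟩
        have hae : a = fun i => if hi : i ∈ σ then a (⟨i, hi⟩ : σ) else 0 := by
          funext i
          by_cases hi : i ∈ σ
          · simp [hi]
          · simp [hi, ha0 i hi]
        rw [hae, homogenizedCombination_extend p σ fun i => a i, Prod.mk.injEq] at haz
        refine ⟨fun i => a i, fun i => ha i i.2, haz.2, fun j => ?_⟩
        simpa [p] using congrFun haz.1 j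
      · rintro ⟨a, ha, hak, haz⟩
        refine ⟨fun i => if hi : i ∈ σ then a ⟨i, hi⟩ else 0, fun i hi => by simp [hi, ha],
          fun i hi => by simp [hi], ?_⟩
        rw [homogenizedCombination_extend, hak]
        congr 1
        funext j
        simpa [p] using haz j

end Polytope

/-- Every integral partial polytopal complex (a finite disjoint union of relatively open
lattice polytopes) of dimension at most `d` has an Ehrhart polynomial whose `f*`-vector
with respect to `d` is a vector of non-negative integers. -/
theorem fstar_nonneg_partial_complex (n d N : ℕ) (V : Fin N → Finset (Fin n → ℤ))
    (hdim : ∀ t, Module.finrank ℝ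
      (vectorSpan ℝ ((fun z : Fin n → ℤ => fun j => ((z j : ℝ))) '' (V t))) ≤ d)
    (hdisj : ∀ s t, s ≠ t →
      Disjoint (openLatticePolytope n (V s)) (openLatticePolytope n (V t))) :
    ∃ f : ℕ → ℚ, (∀ i, ∃ m : ℕ, f i = (m : ℚ)) ∧
      ∀ k : ℕ, 1 ≤ k →
        (Set.ncard {z : Fin n → ℤ |
            ((fun j => ((z j : ℝ))) : Fin n → ℝ) ∈ ((k : ℝ) • (⋃ t, openLatticePolytope n (V t)) : Set (Fin n → ℝ))} : ℚ) =
          ∑ i ∈ Finset.range (d + 1), f i * (binomDesc i).eval (k : ℚ) := by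
  obtain ⟨f, hf⟩ := HasFStar.biUnion (d := d) Finset.univ
    (fun t k => {z : Fin n → ℤ | ((fun j => ((z j : ℝ))) : Fin n → ℝ) ∈
      ((k : ℝ) • openLatticePolytope n (V t) : Set (Fin n → ℝ))})
    (fun s _ t _ hst k hk => by
      have hk0 : (k : ℝ) ≠ 0 := by positivity
      rw [Set.disjoint_left]
      intro z hz hz'
      exact Set.disjoint_left.1 (hdisj s t hst) ((Set.mem_smul_set_iff_inv_smul_mem₀ hk0 _ _).1 hz)
        ((Set.mem_smul_set_iff_inv_smul_mem₀ hk0 _ _).1 hz'))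
    fun t _ => hasFStar_openLatticePolytope (V t) (hdim t)
  refine ⟨fun i => f i, fun i => ⟨f i, rfl⟩, fun k hk => ?_⟩
  have hset : {z : Fin n → ℤ | ((fun j => ((z j : ℝ))) : Fin n → ℝ) ∈
        ((k : ℝ) • (⋃ t, openLatticePolytope n (V t)) : Set (Fin n → ℝ))} =
      ⋃ t ∈ Finset.univ, {z : Fin n → ℤ | ((fun j => ((z j : ℝ))) : Fin n → ℝ) ∈
        ((k : ℝ) • openLatticePolytope n (V t) : Set (Fin n → ℝ))} := by
    ext z
    simp [Set.smul_set_iUnion]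
  rw [hset, (hf k hk).2]
  push_cast
  exact Finset.sum_congr rfl fun i _ => by rw [binomDesc_eval i hk]
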